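/- For every integer k ≥ 3, one has (k−1)·ζ(k) = Σ_{n=2}^{k−1} (2^n − 2)·ζ(k−n, n), where ζ(a,b) = Σ_{0<m_1<m_2} 1/(m_1^a·m_2^b) is the double zeta value (with a ≥ 1, b ≥ 2) and ζ(k) = Σ_{m≥1} 1/m^k. -/

import Mathlib

/-- The single zeta value `ζ(k) = Σ_{m ≥ 1} 1/m^k` as a real series. -/
noncomputable def zeta1 (k : ℕ) : ℝ :=
  ∑' m : ℕ, if 0 < m then 1 / (m : ℝ) ^ k else 0

/-- The double zeta value `ζ(a,b) = Σ_{0<m₁<m₂} 1/(m₁^a m₂^b)`. -/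
noncomputable def zeta2 (a b : ℕ) : ℝ :=
  ∑' p : ℕ × ℕ, if 0 < p.1 ∧ p.1 < p.2 then 1 / ((p.1 : ℝ) ^ a * (p.2 : ℝ) ^ b) else 0

open Finset Filter Topology

/-- The complete homogeneous sum `Σ_{r+s=m+2, r,s≥1} x^r y^s`. -/
noncomputable def homSum (m : ℕ) (x y : ℝ) : ℝ :=
  ∑ i ∈ range (m + 1), x ^ (m + 1 - i) * y ^ (i + 1)

theorem homSum_succ (m : ℕ) (x y : ℝ) :
    homSum (m + 1) x y = x * homSum m x y + x * y ^ (m + 2) := by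
  unfold homSum
  rw [sum_range_succ _ (m + 1), mul_sum]
  congr 1
  · refine sum_congr rfl fun i hi => ?_
    have : m + 1 + 1 - i = (m + 1 - i) + 1 := by have := mem_range.1 hi; omega
    rw [this]; ring
  · have : m + 1 + 1 - (m + 1) = 1 := by omega
    rw [this]; ring

theorem homSum_comm (m : ℕ) (x y : ℝ) : homSum m x y = homSum m y x := by
  unfold homSum
  rw [← sum_range_reflect]
  refine sum_congr rfl fun i hi => ?_
  have hi' := mem_range.1 hi
  have h1 : m + 1 - (m + 1 - 1 - i) = i + 1 := by omega
  have h2 : m + 1 - 1 - i + 1 = m + 1 - i := by omega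
  rw [h1, h2]; ring

/-- Partial fractions: if `xy = z(x+y)`, then products of powers of `x` and `y` become
products with powers of `z`. -/
theorem two_mul_homSum_eq (m : ℕ) {x y z : ℝ} (hs : x + y ≠ 0) (h : x * y = z * (x + y)) :
    2 * homSum m x y = homSum m x (2 * z) + homSum m y (2 * z) := by
  induction m with
  | zero => simp [homSum]; linarith
  | succ m ih =>
    have hx := homSum_succ m x y
    have hy := homSum_succ m y x
    rw [homSum_comm (m + 1) y x, homSum_comm m y x] at hy
    have hz (t : ℝ) : homSum (m + 1) t (2 * z) = 2 * z * homSum m t (2 * z)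
        + 2 * z * t ^ (m + 2) := by
      rw [homSum_comm (m + 1), homSum_succ, homSum_comm m]
    rw [hz, hz]
    refine mul_left_cancel₀ hs ?_
    linear_combination 2 * y * hx + 2 * x * hy + 2 * z * (x + y) * ih
      + (4 * homSum m x y + 2 * x ^ (m + 2) + 2 * y ^ (m + 2)) * h

theorem homSum_self (m : ℕ) (x : ℝ) : homSum m x x = (m + 1) * x ^ (m + 2) := by
  unfold homSum
  rw [sum_congr rfl (g := fun _ => x ^ (m + 2))]
  · simp
  · intro i hi
    rw [← pow_add]
    congr 1
    have := mem_range.1 hi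
    omega

theorem homSum_nonneg (m : ℕ) {x y : ℝ} (hx : 0 ≤ x) (hy : 0 ≤ y) : 0 ≤ homSum m x y :=
  sum_nonneg fun _ _ => by positivity

theorem homSum_le (m : ℕ) (hm : 1 ≤ m) {x y : ℝ} (hx : 0 ≤ x) (hy : 0 ≤ y) (hx1 : x ≤ 1)
    (hy1 : y ≤ 1) : homSum m x y ≤ (m + 1) * (x ^ 2 * y + y ^ 2 * x) := by
  have key : ∀ i ∈ range (m + 1), x ^ (m + 1 - i) * y ^ (i + 1) ≤ x ^ 2 * y + y ^ 2 * x := by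
    intro i hi
    have hi' := mem_range.1 hi
    have p1 : 0 ≤ x ^ 2 * y := by positivity
    have p2 : 0 ≤ y ^ 2 * x := by positivity
    rcases Nat.eq_zero_or_pos i with rfl | h
    · have : x ^ (m + 1 - 0) ≤ x ^ 2 := pow_le_pow_of_le_one hx hx1 (by omega)
      have := mul_le_mul_of_nonneg_right this hy
      simp only [zero_add, pow_one]
      linarith
    · have h1 : x ^ (m + 1 - i) ≤ x ^ 1 := pow_le_pow_of_le_one hx hx1 (by omega)
      have h2 : y ^ (i + 1) ≤ y ^ 2 := pow_le_pow_of_le_one hy hy1 (by omega)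
      have := mul_le_mul h1 h2 (by positivity) (by positivity)
      rw [pow_one] at this
      linarith
  refine (sum_le_sum key).trans (le_of_eq ?_)
  rw [sum_const, card_range, nsmul_eq_mul]
  push_cast
  rfl

/-- The square `[1, N]²`. -/
def sqBox (N : ℕ) : Finset (ℕ × ℕ) := Icc 1 N ×ˢ Icc 1 N

theorem sum_sqBox_swap (N : ℕ) (P : ℕ × ℕ → Prop) [DecidablePred P] (f : ℕ × ℕ → ℝ) :
    ∑ p ∈ sqBox N with P p, f p = ∑ p ∈ sqBox N with P p.swap, f p.swap := by
  refine sum_nbij' Prod.swap Prod.swap ?_ ?_ ?_ ?_ ?_ <;> simp [sqBox] <;> tauto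

theorem sum_sqBox_homSum (N m : ℕ) :
    ∑ p ∈ sqBox N, homSum m (p.1 : ℝ)⁻¹ (p.2 : ℝ)⁻¹ =
      2 * ∑ p ∈ sqBox N with p.1 < p.2, homSum m (p.1 : ℝ)⁻¹ (p.2 : ℝ)⁻¹
        + (m + 1) * ∑ a ∈ Icc 1 N, (a : ℝ)⁻¹ ^ (m + 2) := by
  rw [← sum_filter_add_sum_filter_not (sqBox N) (fun p => p.1 < p.2),
    ← sum_filter_add_sum_filter_not ((sqBox N).filter (fun p => ¬ p.1 < p.2))
      (fun p => p.2 < p.1), filter_filter, filter_filter]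
  have h1 : ∑ p ∈ sqBox N with ¬ p.1 < p.2 ∧ p.2 < p.1, homSum m (p.1 : ℝ)⁻¹ (p.2 : ℝ)⁻¹ =
      ∑ p ∈ sqBox N with p.1 < p.2, homSum m (p.1 : ℝ)⁻¹ (p.2 : ℝ)⁻¹ := by
    rw [sum_sqBox_swap]
    refine sum_congr ?_ fun p _ => homSum_comm _ _ _
    ext p
    simp only [mem_filter, Prod.fst_swap, Prod.snd_swap]
    constructor <;> rintro ⟨h, h'⟩ <;> refine ⟨h, ?_⟩ <;> omega
  have h2 : ∑ p ∈ sqBox N with ¬ p.1 < p.2 ∧ ¬ p.2 < p.1, homSum m (p.1 : ℝ)⁻¹ (p.2 : ℝ)⁻¹ =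
      (m + 1) * ∑ a ∈ Icc 1 N, (a : ℝ)⁻¹ ^ (m + 2) := by
    rw [mul_sum]
    symm
    refine sum_nbij' (fun a => (a, a)) Prod.fst ?_ ?_ ?_ ?_ ?_
    · simp [sqBox]
    · simp +contextual [sqBox]
    · simp
    · rintro ⟨a, b⟩ h
      simp only [mem_filter] at h
      ext <;> simp; omega
    · intro a _
      exact (homSum_self m _).symm
  rw [h1, h2]; ring

theorem sum_triangle_homSum (N m : ℕ) :
    ∑ p ∈ sqBox N with p.1 + p.2 ≤ N, homSum m (p.1 : ℝ)⁻¹ (p.2 : ℝ)⁻¹ =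
      ∑ p ∈ sqBox N with p.1 < p.2, homSum m (p.1 : ℝ)⁻¹ (2 * (p.2 : ℝ)⁻¹) := by
  have h1 : ∑ p ∈ sqBox N with p.1 < p.2, homSum m (p.1 : ℝ)⁻¹ (2 * (p.2 : ℝ)⁻¹) =
      ∑ p ∈ sqBox N with p.1 + p.2 ≤ N, homSum m (p.1 : ℝ)⁻¹ (2 * ((p.1 + p.2 : ℕ) : ℝ)⁻¹) := by
    symm
    refine sum_nbij' (fun p => (p.1, p.1 + p.2)) (fun p => (p.1, p.2 - p.1)) ?_ ?_ ?_ ?_ ?_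
    · rintro ⟨a, b⟩ h; simp [sqBox] at h ⊢; omega
    · rintro ⟨a, b⟩ h; simp [sqBox] at h ⊢; omega
    · rintro ⟨a, b⟩ h; simp
    · rintro ⟨a, b⟩ h; simp [sqBox] at h ⊢; omega
    · intro p _; rfl
  have h2 : ∑ p ∈ sqBox N with p.1 + p.2 ≤ N,
        homSum m (p.1 : ℝ)⁻¹ (2 * ((p.1 + p.2 : ℕ) : ℝ)⁻¹) =
      ∑ p ∈ sqBox N with p.1 + p.2 ≤ N, homSum m (p.2 : ℝ)⁻¹ (2 * ((p.1 + p.2 : ℕ) : ℝ)⁻¹) := by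
    rw [sum_sqBox_swap]
    refine sum_congr ?_ fun p _ => ?_
    · ext p; simp [add_comm]
    · simp [add_comm]
  have h3 : 2 * ∑ p ∈ sqBox N with p.1 + p.2 ≤ N, homSum m (p.1 : ℝ)⁻¹ (p.2 : ℝ)⁻¹ =
      ∑ p ∈ sqBox N with p.1 + p.2 ≤ N, homSum m (p.1 : ℝ)⁻¹ (2 * ((p.1 + p.2 : ℕ) : ℝ)⁻¹) +
      ∑ p ∈ sqBox N with p.1 + p.2 ≤ N, homSum m (p.2 : ℝ)⁻¹ (2 * ((p.1 + p.2 : ℕ) : ℝ)⁻¹) := by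
    rw [mul_sum, ← sum_add_distrib]
    refine sum_congr rfl fun p hp => ?_
    simp only [sqBox, mem_filter, mem_product, mem_Icc] at hp
    have ha : (0 : ℝ) < p.1 := by norm_cast; omega
    have hb : (0 : ℝ) < p.2 := by norm_cast; omega
    refine two_mul_homSum_eq m (by positivity) ?_
    push_cast
    field_simp
    ring
  linarith

/-- The corner `a, b ≤ N < a + b` contributes a vanishing amount. -/
theorem tendsto_sum_corner :
    Tendsto (fun N : ℕ => ∑ p ∈ sqBox N with ¬ p.1 + p.2 ≤ N, (p.1 : ℝ)⁻¹ ^ 2 * (p.2 : ℝ)⁻¹)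
      atTop (𝓝 0) := by
  have hces : Tendsto (fun N : ℕ => 2 * ((N : ℝ)⁻¹ * ∑ i ∈ range N, 1 / ((i : ℝ) + 1)))
      atTop (𝓝 0) := by
    simpa using (tendsto_one_div_add_atTop_nhds_zero_nat (𝕜 := ℝ)).cesaro.const_mul 2
  refine squeeze_zero (fun N => sum_nonneg fun _ _ => by positivity) (fun N => ?_) hces
  rcases Nat.eq_zero_or_pos N with rfl | hN
  · simp [sqBox]
  have hrow : ∀ a ∈ Icc 1 N, ∑ b ∈ Icc 1 N, (if ¬ a + b ≤ N then (a : ℝ)⁻¹ ^ 2 * (b : ℝ)⁻¹ else 0)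
      ≤ (N : ℝ)⁻¹ * ((a : ℝ)⁻¹ + ((N + 1 - a : ℕ) : ℝ)⁻¹) := by
    intro a ha
    have ha' := mem_Icc.1 ha
    have ha0 : (0 : ℝ) < a := by norm_cast; omega
    have hNa : (0 : ℝ) < (N + 1 - a : ℕ) := by norm_cast; omega
    have hN0 : (0 : ℝ) < N := by norm_cast
    have hcast : ((N + 1 - a : ℕ) : ℝ) = N + 1 - a := by
      rw [Nat.cast_sub (by omega)]; push_cast; ring
    rw [← sum_filter]
    have hset : (Icc 1 N).filter (fun b => ¬ a + b ≤ N) = Icc (N + 1 - a) N := by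
      ext b; simp only [mem_filter, mem_Icc]; omega
    rw [hset]
    have : ∀ b ∈ Icc (N + 1 - a) N, (a : ℝ)⁻¹ ^ 2 * (b : ℝ)⁻¹ ≤
        (a : ℝ)⁻¹ ^ 2 * ((N + 1 - a : ℕ) : ℝ)⁻¹ := by
      intro b hb
      have : ((N + 1 - a : ℕ) : ℝ) ≤ b := by exact_mod_cast (mem_Icc.1 hb).1
      gcongr
    refine (sum_le_sum this).trans ?_
    have hcard : N + 1 - (N + 1 - a) = a := by omega
    rw [sum_const, Nat.card_Icc, hcard, nsmul_eq_mul]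
    have e1 : (a : ℝ) * ((a : ℝ)⁻¹ ^ 2 * ((N + 1 - a : ℕ) : ℝ)⁻¹) =
        ((N : ℝ) + 1)⁻¹ * ((a : ℝ)⁻¹ + ((N + 1 - a : ℕ) : ℝ)⁻¹) := by
      rw [hcast] at hNa ⊢
      field_simp
      ring
    rw [e1]
    gcongr
    linarith
  rw [sum_filter, sqBox, sum_product]
  refine (sum_le_sum hrow).trans (le_of_eq ?_)
  have hIcc (f : ℕ → ℝ) : ∑ a ∈ Icc 1 N, f a = ∑ i ∈ range N, f (i + 1) := by
    rw [range_eq_Ico, sum_Ico_add' f 0 N 1]; rfl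
  rw [← mul_sum, sum_add_distrib, hIcc, hIcc]
  have hrefl : ∑ i ∈ range N, ((N + 1 - (i + 1) : ℕ) : ℝ)⁻¹ =
      ∑ i ∈ range N, ((i + 1 : ℕ) : ℝ)⁻¹ := by
    rw [← sum_range_reflect]
    refine sum_congr rfl fun i hi => ?_
    have := mem_range.1 hi
    congr 2
    omega
  rw [hrefl]
  simp only [one_div, Nat.cast_add, Nat.cast_one]
  ring

theorem tendsto_sum_corner_homSum (m : ℕ) (hm : 1 ≤ m) :
    Tendsto (fun N : ℕ => ∑ p ∈ sqBox N with ¬ p.1 + p.2 ≤ N,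
      homSum m (p.1 : ℝ)⁻¹ (p.2 : ℝ)⁻¹) atTop (𝓝 0) := by
  have h := tendsto_sum_corner.const_mul ((m + 1 : ℝ) * 2)
  rw [mul_zero] at h
  refine squeeze_zero (fun N => sum_nonneg fun p _ => homSum_nonneg m (by positivity)
    (by positivity)) (fun N => ?_) h
  have hswap : ∑ p ∈ sqBox N with ¬ p.1 + p.2 ≤ N, (p.1 : ℝ)⁻¹ ^ 2 * (p.2 : ℝ)⁻¹ =
      ∑ p ∈ sqBox N with ¬ p.1 + p.2 ≤ N, (p.2 : ℝ)⁻¹ ^ 2 * (p.1 : ℝ)⁻¹ := by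
    rw [sum_sqBox_swap]
    refine sum_congr ?_ fun p _ => rfl
    ext p; simp [add_comm]
  calc _ ≤ ∑ p ∈ sqBox N with ¬ p.1 + p.2 ≤ N,
        (m + 1 : ℝ) * ((p.1 : ℝ)⁻¹ ^ 2 * (p.2 : ℝ)⁻¹ + (p.2 : ℝ)⁻¹ ^ 2 * (p.1 : ℝ)⁻¹) :=
        sum_le_sum fun p _ => homSum_le m hm (by positivity) (by positivity)
          (Nat.cast_inv_le_one _) (Nat.cast_inv_le_one _)
    _ = _ := by
        rw [← mul_sum, sum_add_distrib, ← hswap]; ring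

theorem summable_zeta2 {a b : ℕ} (ha : 1 ≤ a) (hb : 2 ≤ b) :
    Summable fun p : ℕ × ℕ =>
      if 0 < p.1 ∧ p.1 < p.2 then 1 / ((p.1 : ℝ) ^ a * (p.2 : ℝ) ^ b) else 0 := by
  have h1 : Summable fun n : ℕ => 1 / (n : ℝ) ^ (3 / 2 : ℝ) :=
    Real.summable_one_div_nat_rpow.2 (by norm_num)
  have h2 := h1.mul_of_nonneg h1 (fun n => by positivity) (fun n => by positivity)
  refine h2.of_nonneg_of_le (fun p => ?_) (fun p => ?_)
  · split_ifs <;> positivity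
  · split_ifs with h
    · have hp1 : (1 : ℝ) ≤ p.1 := by exact_mod_cast h.1
      have hp : (p.1 : ℝ) ≤ p.2 := by exact_mod_cast h.2.le
      have hp2 : (1 : ℝ) ≤ p.2 := hp1.trans hp
      have hsq (x : ℝ) (hx : 1 ≤ x) : x ^ (3 / 2 : ℝ) = x * √x := by
        rw [Real.sqrt_eq_rpow, show (3 / 2 : ℝ) = 1 + 1 / 2 by norm_num,
          Real.rpow_add (by linarith), Real.rpow_one]
      rw [one_div_mul_one_div, hsq _ hp1, hsq _ hp2]
      refine one_div_le_one_div_of_le (by positivity) ?_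
      calc (p.1 : ℝ) * √p.1 * (p.2 * √p.2) ≤ p.1 * √p.2 * (p.2 * √p.2) := by gcongr
        _ = p.1 ^ 1 * p.2 ^ 2 := by
          have := Real.mul_self_sqrt (zero_le_one.trans hp2)
          linear_combination (p.1 : ℝ) * p.2 * this
        _ ≤ p.1 ^ a * p.2 ^ b := by gcongr
    · positivity

theorem tendsto_sum_sqBox_zeta2 {a b : ℕ} (ha : 1 ≤ a) (hb : 2 ≤ b) :
    Tendsto (fun N : ℕ => ∑ p ∈ sqBox N with p.1 < p.2, (p.1 : ℝ)⁻¹ ^ a * (p.2 : ℝ)⁻¹ ^ b)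
      atTop (𝓝 (zeta2 a b)) := by
  have hlim : Tendsto (fun N : ℕ => range (N + 1) ×ˢ range (N + 1)) atTop atTop := by
    refine tendsto_atTop_finset_of_monotone (fun M N h => ?_) fun p => ⟨max p.1 p.2, ?_⟩
    · exact product_subset_product (range_mono (by omega)) (range_mono (by omega))
    · simp
  refine ((summable_zeta2 ha hb).hasSum.comp hlim).congr fun N => ?_
  simp only [Function.comp_apply]
  rw [← sum_filter]
  refine sum_congr ?_ fun p _ => by simp [mul_comm]
  ext p
  simp only [sqBox, mem_filter, mem_product, mem_range, mem_Icc]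
  omega

theorem tendsto_sum_zeta1 {k : ℕ} (hk : 2 ≤ k) :
    Tendsto (fun N : ℕ => ∑ a ∈ Icc 1 N, (a : ℝ)⁻¹ ^ k) atTop (𝓝 (zeta1 k)) := by
  have hs : Summable fun m : ℕ => if 0 < m then 1 / (m : ℝ) ^ k else 0 := by
    refine (Real.summable_one_div_nat_pow.2 hk).congr fun m => ?_
    rcases Nat.eq_zero_or_pos m with rfl | h
    · simp; omega
    · simp [h]
  have hlim : Tendsto (fun N : ℕ => range (N + 1)) atTop atTop :=
    tendsto_finset_range.comp (tendsto_add_atTop_nat 1)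
  refine (hs.hasSum.comp hlim).congr fun N => ?_
  simp only [Function.comp_apply]
  rw [← sum_filter]
  refine sum_congr ?_ fun p _ => by simp
  ext p
  simp only [mem_filter, mem_range, mem_Icc]
  omega

theorem homSum_two_mul_sub (m : ℕ) (x z : ℝ) :
    homSum m x (2 * z) - 2 * homSum m x z =
      ∑ n ∈ Icc 2 (m + 1), ((2 : ℝ) ^ n - 2) * (x ^ (m + 2 - n) * z ^ n) := by
  unfold homSum
  rw [mul_sum, ← sum_sub_distrib, sum_range_succ', range_eq_Ico]
  have := sum_Ico_add' (fun n => ((2 : ℝ) ^ n - 2) * (x ^ (m + 2 - n) * z ^ n)) 0 m 2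
  have hI : Ico (0 + 2) (m + 2) = Icc 2 (m + 1) := by ext; simp; omega
  rw [hI] at this
  rw [← this]
  simp only [zero_add, pow_one]
  rw [show x ^ (m + 1 - 0) * (2 * z) - 2 * (x ^ (m + 1 - 0) * z) = 0 by ring, add_zero]
  refine sum_congr rfl fun i _ => ?_
  have : m + 2 - (i + 2) = m + 1 - (i + 1) := by omega
  rw [this]
  ring

/-- `(k−1) ζ(k) = Σ_{n=2}^{k−1} (2ⁿ−2) ζ(k−n,n)` for `k ≥ 3`. -/
theorem stmt_10 (k : ℕ) (hk : 3 ≤ k) :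
    ((k : ℝ) - 1) * zeta1 k =
      ∑ n ∈ Finset.Icc 2 (k - 1), ((2 : ℝ) ^ n - 2) * zeta2 (k - n) n := by

  obtain ⟨m, rfl⟩ : ∃ m, k = m + 2 := ⟨k - 2, by omega⟩
  have hfin (N : ℕ) : ∑ n ∈ Icc 2 (m + 1), ((2 : ℝ) ^ n - 2) *
        ∑ p ∈ sqBox N with p.1 < p.2, (p.1 : ℝ)⁻¹ ^ (m + 2 - n) * (p.2 : ℝ)⁻¹ ^ n =
      (m + 1) * ∑ a ∈ Icc 1 N, (a : ℝ)⁻¹ ^ (m + 2) -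
        ∑ p ∈ sqBox N with ¬ p.1 + p.2 ≤ N, homSum m (p.1 : ℝ)⁻¹ (p.2 : ℝ)⁻¹ := by
    simp only [mul_sum]
    rw [sum_comm]
    simp only [← homSum_two_mul_sub, ← mul_sum]
    rw [sum_sub_distrib, ← mul_sum]
    have h1 := sum_sqBox_homSum N m
    have h2 := sum_triangle_homSum N m
    have h3 := sum_filter_add_sum_filter_not (sqBox N) (fun p => p.1 + p.2 ≤ N)
      (fun p => homSum m (p.1 : ℝ)⁻¹ (p.2 : ℝ)⁻¹)
    linarith
  have hR := ((tendsto_sum_zeta1 (k := m + 2) (by omega)).const_mul ((m : ℝ) + 1)).sub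
    (tendsto_sum_corner_homSum m (by omega))
  have hL : Tendsto (fun N : ℕ => ∑ n ∈ Icc 2 (m + 1), ((2 : ℝ) ^ n - 2) *
        ∑ p ∈ sqBox N with p.1 < p.2, (p.1 : ℝ)⁻¹ ^ (m + 2 - n) * (p.2 : ℝ)⁻¹ ^ n) atTop
      (𝓝 (∑ n ∈ Icc 2 (m + 1), ((2 : ℝ) ^ n - 2) * zeta2 (m + 2 - n) n)) := by
    refine tendsto_finsetSum _ fun n hn => (tendsto_sum_sqBox_zeta2 ?_ ?_).const_mul _ <;>
      have := mem_Icc.1 hn <;> omega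
  have := tendsto_nhds_unique (hL.congr hfin) hR
  have hm : m + 2 - 1 = m + 1 := by omega
  rw [hm, this]
  push_cast
  ring
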